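/- A truncated geometric mixture of geometric sums is geometric. Let 0 ≤ β < γ < 1 and let n ≥ 1. On a probability space, let (T_i)_{i=1}^{n-1} be i.i.d. with Pr(T_i = k) = (1-β) β^{k-1} for k ≥ 1, let T' satisfy Pr(T' = k) = (1-γ) γ^{k-1} for k ≥ 1, and let N' take values in {1,…,n} with Pr(N' = m) = ((1-γ)/(1-β)) ((γ-β)/(1-β))^{m-1} for m = 1,…,n-1 and Pr(N' = n) = ((γ-β)/(1-β))^{n-1}; assume (T_i)_{i=1}^{n-1}, T', and N' are jointly independent. Then the random sum ∑_{i=1}^{min(N', n-1)} T_i + 1{N' = n} · T' has the Geometric(1-γ) distribution on {1,2,…}: its probability of equaling k is (1-γ) γ^{k-1} for every k ≥ 1. -/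

import Mathlib

open scoped BigOperators
open MeasureTheory ProbabilityTheory

noncomputable def lawSeries {Ω : Type} [MeasurableSpace Ω] (Pr : Measure Ω) (X : Ω → ℕ) :
    PowerSeries ℝ := PowerSeries.mk fun k => Pr.real (X ⁻¹' {k})

noncomputable def geomSeries (b : ℝ) : PowerSeries ℝ :=
  PowerSeries.mk fun k => if k = 0 then 0 else (1 - b) * b ^ (k - 1)

theorem geomSeries_mul (b : ℝ) :
    geomSeries b * (1 - PowerSeries.C b * PowerSeries.X) =
      PowerSeries.C (1 - b) * PowerSeries.X := by
  ext k
  have h : geomSeries b * (1 - PowerSeries.C b * PowerSeries.X) =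
    geomSeries b - PowerSeries.C b * (geomSeries b * PowerSeries.X) := by ring
  rw [h]
  rcases k with _ | _ | k
  · simp [geomSeries]
  · simp [geomSeries, PowerSeries.coeff_succ_mul_X, PowerSeries.coeff_C_mul]
  · simp [geomSeries, PowerSeries.coeff_succ_mul_X, PowerSeries.coeff_C_mul]
    ring

theorem geomSeries_step (β γ : ℝ) (hβγ : β < γ) (hγ1 : γ < 1) :
    geomSeries γ = PowerSeries.C ((1 - γ) / (1 - β)) * geomSeries β +
      PowerSeries.C ((γ - β) / (1 - β)) * (geomSeries β * geomSeries γ) := by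
  have hne : ∀ b : ℝ, (1 - PowerSeries.C b * PowerSeries.X : PowerSeries ℝ) ≠ 0 := by
    intro b h
    have := congrArg (PowerSeries.coeff 0) h
    simp at this
  have hb : (1 - β) ≠ 0 := by linarith
  apply mul_right_cancel₀ (hne γ)
  apply mul_right_cancel₀ (hne β)
  have h1 := geomSeries_mul β
  have h2 := geomSeries_mul γ
  have hp : (PowerSeries.C ((1 - γ) / (1 - β)) * PowerSeries.C (1 - β) : PowerSeries ℝ)
      = 1 - PowerSeries.C γ := by
    rw [← map_mul, div_mul_cancel₀ _ hb]; simp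
  have hq : (PowerSeries.C ((γ - β) / (1 - β)) * PowerSeries.C (1 - β) : PowerSeries ℝ)
      = PowerSeries.C γ - PowerSeries.C β := by
    rw [← map_mul, div_mul_cancel₀ _ hb]; simp
  have hc : (PowerSeries.C (1 - γ) : PowerSeries ℝ) = 1 - PowerSeries.C γ := by simp
  rw [hc] at h2
  generalize (PowerSeries.C (1 - β) : PowerSeries ℝ) = cb at *
  generalize (PowerSeries.C ((1 - γ) / (1 - β)) : PowerSeries ℝ) = p at *
  generalize (PowerSeries.C ((γ - β) / (1 - β)) : PowerSeries ℝ) = q at *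
  generalize (PowerSeries.C γ : PowerSeries ℝ) = c at *
  generalize (PowerSeries.C β : PowerSeries ℝ) = b at *
  generalize geomSeries β = A at *
  generalize geomSeries γ = G at *
  generalize (PowerSeries.X : PowerSeries ℝ) = x at *
  calc G * (1 - c * x) * (1 - b * x) = (1 - c) * x * (1 - b * x) := by rw [h2]
    _ = (1 - c) * x * (1 - c * x) + (c - b) * x * ((1 - c) * x) := by ring
    _ = p * (cb * x) * (1 - c * x) + q * (cb * x) * ((1 - c) * x) := by
      rw [← hp, ← hq]; ring
    _ = _ := by rw [← h1, ← h2]; ring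

theorem geomSeries_iter (β γ : ℝ) (hβγ : β < γ) (hγ1 : γ < 1) (n : ℕ) :
    geomSeries γ = ∑ m ∈ Finset.range n,
      PowerSeries.C ((1 - γ) / (1 - β) * ((γ - β) / (1 - β)) ^ m) * geomSeries β ^ (m + 1) +
      PowerSeries.C (((γ - β) / (1 - β)) ^ n) * (geomSeries β ^ n * geomSeries γ) := by
  induction n with
  | zero => simp
  | succ n ih =>
    rw [Finset.sum_range_succ]
    have hs := geomSeries_step β γ hβγ hγ1
    simp only [map_mul, map_pow] at ih ⊢
    linear_combination ih + PowerSeries.C ((γ - β) / (1 - β)) ^ n * geomSeries β ^ n * hs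

theorem lawSeries_add {Ω : Type} [MeasurableSpace Ω] (Pr : Measure Ω) [IsProbabilityMeasure Pr]
    (X Y : Ω → ℕ) (hX : Measurable X) (hY : Measurable Y) (h : IndepFun X Y Pr) :
    lawSeries Pr (X + Y) = lawSeries Pr X * lawSeries Pr Y := by
  ext k
  rw [PowerSeries.coeff_mul]
  simp only [lawSeries, PowerSeries.coeff_mk]
  have : (X + Y) ⁻¹' {k} = ⋃ p ∈ Finset.HasAntidiagonal.antidiagonal k, (X ⁻¹' {p.1} ∩ Y ⁻¹' {p.2}) := by
    ext ω; simp
  rw [this, measureReal_biUnion_finset]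
  · apply Finset.sum_congr rfl
    intro p _
    simp only [measureReal_def]
    rw [h.measure_inter_preimage_eq_mul _ _ (measurableSet_singleton _) (measurableSet_singleton _),
      ENNReal.toReal_mul]
  · intro p _ q _ hpq
    refine Set.disjoint_left.2 ?_
    rintro ω ⟨h1, h2⟩ ⟨h3, h4⟩
    apply hpq
    simp only [Set.mem_preimage, Set.mem_singleton_iff] at h1 h2 h3 h4
    ext <;> omega
  · intro p _
    exact (hX (measurableSet_singleton _)).inter (hY (measurableSet_singleton _))

theorem lawSeries_sum {Ω ι : Type} [MeasurableSpace Ω] (Pr : Measure Ω) [IsProbabilityMeasure Pr]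
    (f : ι → Ω → ℕ) (hf : ∀ i, Measurable (f i)) (h : iIndepFun f Pr) (s : Finset ι) :
    lawSeries Pr (∑ i ∈ s, f i) = ∏ i ∈ s, lawSeries Pr (f i) := by
  classical
  induction s using Finset.induction_on with
  | empty =>
    ext k
    simp only [Finset.sum_empty, Finset.prod_empty, lawSeries, PowerSeries.coeff_mk,
      PowerSeries.coeff_one]
    by_cases hk : k = 0
    · subst hk
      have : (0 : Ω → ℕ) ⁻¹' {0} = Set.univ := by ext; simp
      rw [this]; simp
    · have : (0 : Ω → ℕ) ⁻¹' {k} = ∅ := by ext; simp [Ne.symm hk]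
      rw [this]; simp [hk]
  | insert a s ha ih =>
    rw [Finset.sum_insert ha, Finset.prod_insert ha, lawSeries_add, ih]
    · exact hf a
    · rw [show (∑ i ∈ s, f i) = fun ω => ∑ i ∈ s, f i ω from by ext; simp]
      exact Finset.measurable_sum _ (fun i _ => hf i)
    · exact (h.indepFun_finsetSum_of_notMem hf ha).symm

theorem lawSeries_geom {Ω : Type} [MeasurableSpace Ω] (Pr : Measure Ω)
    (b : ℝ) (hb : 0 ≤ b) (hb1 : b < 1) (X : Ω → ℕ) (hX : ∀ ω, 1 ≤ X ω)
    (h : ∀ k, 1 ≤ k → Pr {ω | X ω = k} = ENNReal.ofReal ((1 - b) * b ^ (k - 1))) :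
    lawSeries Pr X = geomSeries b := by
  ext k
  simp only [lawSeries, geomSeries, PowerSeries.coeff_mk, measureReal_def]
  split_ifs with hk
  · have : X ⁻¹' {k} = ∅ := by
      ext ω; have := hX ω; simp; omega
    rw [this]; simp
  · have := h k (by omega)
    change (Pr {ω | X ω = k}).toReal = _
    rw [this, ENNReal.toReal_ofReal]
    exact mul_nonneg (by linarith) (pow_nonneg hb _)

/-- **A truncated geometric mixture of geometric sums is geometric.**
Let `0 ≤ β < γ < 1` and `n ≥ 1`.  On a probability space, let `(T i)_{i : Fin (n-1)}` be
i.i.d. with `Pr(T i = k) = (1-β) β^(k-1)` on `{1,2,…}`, let `T'` be `Geometric(1-γ)`, and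
let `N'` take values in `{1,…,n}` with `Pr(N' = m) = ((1-γ)/(1-β)) ((γ-β)/(1-β))^(m-1)`
for `m = 1,…,n-1` and `Pr(N' = n) = ((γ-β)/(1-β))^(n-1)`, all jointly independent
(joint independence of the family `Sum.elim T (fun b => if b then T' else N')`).
Then `∑_{i=1}^{min(N', n-1)} T i + 1{N' = n} T'` has the `Geometric(1-γ)` distribution:
its probability of equaling `k` is `(1-γ) γ^(k-1)` for every `k ≥ 1`. -/
theorem truncated_geometric_mixture_geometric
    {Ω : Type} [MeasurableSpace Ω] (Pr : Measure Ω) [IsProbabilityMeasure Pr]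
    (β γ : ℝ) (hβ0 : 0 ≤ β) (hβγ : β < γ) (hγ1 : γ < 1)
    (n : ℕ) (hn : 1 ≤ n)
    (T : Fin (n - 1) → Ω → ℕ) (T' : Ω → ℕ) (N' : Ω → ℕ)
    (hT1 : ∀ i ω, 1 ≤ T i ω) (hT'1 : ∀ ω, 1 ≤ T' ω)
    (hN'range : ∀ ω, 1 ≤ N' ω ∧ N' ω ≤ n)
    (hTmeas : ∀ i, Measurable (T i)) (hT'meas : Measurable T') (hN'meas : Measurable N')
    (hTpmf : ∀ i k, 1 ≤ k →
      Pr {ω | T i ω = k} = ENNReal.ofReal ((1 - β) * β ^ (k - 1)))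
    (hT'pmf : ∀ k, 1 ≤ k →
      Pr {ω | T' ω = k} = ENNReal.ofReal ((1 - γ) * γ ^ (k - 1)))
    (hN'pmf : ∀ m, 1 ≤ m → m ≤ n - 1 →
      Pr {ω | N' ω = m} =
        ENNReal.ofReal ((1 - γ) / (1 - β) * ((γ - β) / (1 - β)) ^ (m - 1)))
    (hN'pmfTop : Pr {ω | N' ω = n} = ENNReal.ofReal (((γ - β) / (1 - β)) ^ (n - 1)))
    (hindep : iIndepFun (β := fun _ : Fin (n - 1) ⊕ Bool => ℕ)
      (Sum.elim T (fun b : Bool => if b then T' else N')) Pr) :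
    ∀ k, 1 ≤ k →
      Pr {ω |
          (∑ i ∈ Finset.univ.filter (fun i : Fin (n - 1) => (i : ℕ) < min (N' ω) (n - 1)),
            T i ω) + (if N' ω = n then T' ω else 0) = k} =
        ENNReal.ofReal ((1 - γ) * γ ^ (k - 1)) := by
  intro k hk
  have hb : 0 < 1 - β := by linarith
  have hp0 : 0 ≤ (1 - γ) / (1 - β) := div_nonneg (by linarith) hb.le
  have hq0 : 0 ≤ (γ - β) / (1 - β) := div_nonneg (by linarith) hb.le
  set f : Fin (n - 1) ⊕ Bool → Ω → ℕ :=
    Sum.elim T (fun b : Bool => if b then T' else N') with hf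
  have hfm : ∀ j, Measurable (f j) := by
    rintro (i | b)
    · exact hTmeas i
    · cases b
      · exact hN'meas
      · exact hT'meas
  let s : ℕ → Finset (Fin (n - 1) ⊕ Bool) := fun m =>
    ((Finset.univ.filter (fun i : Fin (n - 1) => (i : ℕ) < min m (n - 1))).disjSum
      (if m = n then {true} else ∅))
  have hLT : ∀ i, lawSeries Pr (T i) = geomSeries β := fun i =>
    lawSeries_geom Pr β hβ0 (by linarith) (T i) (hT1 i) (hTpmf i)
  have hLT' : lawSeries Pr T' = geomSeries γ :=
    lawSeries_geom Pr γ (by linarith) hγ1 T' hT'1 hT'pmf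
  have hcard : ∀ m, (Finset.univ.filter
      (fun i : Fin (n - 1) => (i : ℕ) < min m (n - 1))).card = min m (n - 1) := by
    intro m
    rw [Fin.card_filter_val_lt]
    omega
  have hprod : ∀ m, lawSeries Pr (∑ j ∈ s m, f j) =
      geomSeries β ^ (min m (n - 1)) * (if m = n then geomSeries γ else 1) := by
    intro m
    rw [lawSeries_sum Pr f hfm hindep, Finset.prod_disjSum]
    congr 1
    · rw [Finset.prod_congr rfl (fun i _ => show lawSeries Pr (f (Sum.inl i)) = _ from hLT i), Finset.prod_const, hcard]
    · split_ifs
      · simp [hf, hLT']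
      · simp
  have hev : {ω | (∑ i ∈ Finset.univ.filter
        (fun i : Fin (n - 1) => (i : ℕ) < min (N' ω) (n - 1)),
            T i ω) + (if N' ω = n then T' ω else 0) = k} =
      ⋃ m ∈ Finset.Icc 1 n, ((∑ j ∈ s m, f j) ⁻¹' {k} ∩ N' ⁻¹' {m}) := by
    have key : ∀ m ω, (∑ j ∈ s m, f j) ω = (∑ i ∈ Finset.univ.filter
        (fun i : Fin (n - 1) => (i : ℕ) < min m (n - 1)),
            T i ω) + (if m = n then T' ω else 0) := by
      intro m ω
      rw [Finset.sum_apply, Finset.sum_disjSum]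
      congr 1
      split_ifs <;> simp [hf]
    ext ω
    simp only [Set.mem_ofPred_eq, Set.mem_iUnion, Set.mem_inter_iff, Set.mem_preimage, key,
      Set.mem_singleton_iff, Finset.mem_Icc]
    constructor
    · intro h
      exact ⟨N' ω, hN'range ω, h, rfl⟩
    · rintro ⟨m, _, h, rfl⟩
      exact h
  have hreal : Pr.real {ω | (∑ i ∈ Finset.univ.filter
        (fun i : Fin (n - 1) => (i : ℕ) < min (N' ω) (n - 1)),
            T i ω) + (if N' ω = n then T' ω else 0) = k} =
      ∑ m ∈ Finset.Icc 1 n, Pr.real (N' ⁻¹' {m}) *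
        PowerSeries.coeff k (geomSeries β ^ (min m (n - 1)) *
          (if m = n then geomSeries γ else 1)) := by
    have hSm : ∀ m, Measurable (∑ j ∈ s m, f j) := by
      intro m
      rw [show (∑ j ∈ s m, f j) = fun ω => ∑ j ∈ s m, f j ω from by ext; simp]
      exact Finset.measurable_sum _ (fun i _ => hfm i)
    rw [hev, measureReal_biUnion_finset]
    · apply Finset.sum_congr rfl
      intro m _
      have hnot : (Sum.inr false : Fin (n - 1) ⊕ Bool) ∉ s m := by
        simp only [s, Finset.inr_mem_disjSum]
        split_ifs <;> simp
      have hi : IndepFun (∑ j ∈ s m, f j) N' Pr :=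
        hindep.indepFun_finsetSum_of_notMem hfm hnot
      rw [← hprod m]
      simp only [lawSeries, PowerSeries.coeff_mk, measureReal_def]
      rw [hi.measure_inter_preimage_eq_mul _ _ (measurableSet_singleton _)
        (measurableSet_singleton _), ENNReal.toReal_mul, mul_comm]
    · intro p _ q _ hpq
      refine Set.disjoint_left.2 ?_
      rintro ω ⟨_, h2⟩ ⟨_, h4⟩
      exact hpq (h2.symm.trans h4)
    · intro m _
      exact (hSm m (measurableSet_singleton _)).inter (hN'meas (measurableSet_singleton _))
  rw [← ENNReal.ofReal_toReal (measure_ne_top Pr _)]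
  congr 1
  refine hreal.trans ?_
  have hG : (1 - γ) * γ ^ (k - 1) = PowerSeries.coeff k (geomSeries γ) := by
    simp [geomSeries, Nat.one_le_iff_ne_zero.1 hk]
  have hN : ∀ m, 1 ≤ m → m ≤ n - 1 → Pr.real (N' ⁻¹' {m}) =
      (1 - γ) / (1 - β) * ((γ - β) / (1 - β)) ^ (m - 1) := by
    intro m h1 h2
    change (Pr {ω | N' ω = m}).toReal = _
    rw [hN'pmf m h1 h2, ENNReal.toReal_ofReal (mul_nonneg hp0 (pow_nonneg hq0 _))]
  have hNn : Pr.real (N' ⁻¹' {n}) = ((γ - β) / (1 - β)) ^ (n - 1) := by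
    change (Pr {ω | N' ω = n}).toReal = _
    rw [hN'pmfTop, ENNReal.toReal_ofReal (pow_nonneg hq0 _)]
  rw [hG, congrArg (PowerSeries.coeff k) (geomSeries_iter β γ hβγ hγ1 (n - 1))]
  have hI : Finset.Icc 1 n = Finset.Ico 1 (n + 1) := by
    ext; simp
  obtain ⟨l, hl⟩ : ∃ l, n = l + 1 := ⟨n - 1, by omega⟩
  have hl' : n - 1 = l := by omega
  rw [hI, Finset.sum_Ico_eq_sum_range, Nat.add_sub_cancel]
  rw [hl'] at hN hNn ⊢
  have hr : Finset.range n = Finset.range (l + 1) := by rw [hl]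
  have h1l : 1 + l = n := by omega
  rw [hr, Finset.sum_range_succ, map_add, map_sum, h1l, hNn, if_pos rfl,
    PowerSeries.coeff_C_mul, min_eq_right (by omega : l ≤ n)]
  congr 1
  apply Finset.sum_congr rfl
  intro m hm
  have hm' := Finset.mem_range.1 hm
  rw [hN (1 + m) (by omega) (by omega), if_neg (by omega), mul_one, PowerSeries.coeff_C_mul,
    min_eq_left (by omega), Nat.add_sub_cancel_left, add_comm 1 m]
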